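/- Let φ be a smooth, decaying solution of the Hartree equation, and define ρ := (1/2)|φ|², p_j := (1/2i)(φ ∇_j conj(φ) − conj(φ) ∇_j φ), σ_{jk} := ∇_j conj(φ) ∇_k φ + ∇_k conj(φ) ∇_j φ, e := |∇φ|² + (1/2)(v_N * |φ|²)|φ|², σ_{0j} := ∇_j conj(φ) ∂_t φ + ∂_t conj(φ) ∇_j φ, λ := (1/2)(Δ|φ|² − (v_N * |φ|²)|φ|²), l_j := 2((v_N * ρ) ∇_j ρ − (v_N * ∇_j ρ) ρ), and l_0 := 2((v_N * ρ) ∂_t ρ − (v_N * ∂_t ρ) ρ). Then the local conservation laws hold pointwise: (i) ∂_t ρ − ∇_j p^j = 0 (mass); (ii) ∂_t p_j − ∇_k(σ_j^{ k} − δ_j^{ k} λ) + l_j = 0 (momentum); (iii) ∂_t e − ∇_j σ_0^{ j} + l_0 = 0 (energy), where repeated indices j, k ∈ {1,2,3} are summed. -/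

import Mathlib

open MeasureTheory Real Complex
open scoped ENNReal FourierTransform

noncomputable section

/-- Three-dimensional Euclidean space. -/
abbrev E3 := EuclideanSpace ℝ (Fin 3)

/-- The scaled potential `v_N(x) = N^{3β} v(N^β x)`. -/
def vScaled (N : ℕ) (β : ℝ) (v : E3 → ℝ) : E3 → ℝ :=
  fun x => (N : ℝ) ^ (3 * β) * v (((N : ℝ) ^ β) • x)

/-- `v` is C¹, compactly supported, non-negative, spherically symmetric and decreasing. -/
def IsAdmissiblePotential (v : E3 → ℝ) : Prop :=
  ContDiff ℝ 1 v ∧ HasCompactSupport v ∧ (∀ x, 0 ≤ v x) ∧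
  (∀ x y : E3, ‖x‖ = ‖y‖ → v x = v y) ∧
  (∀ x y : E3, ‖x‖ ≤ ‖y‖ → v y ≤ v x)

/-- Time derivative `∂ₜ φ`. -/
def timeDeriv (φ : ℝ → E3 → ℂ) (t : ℝ) (x : E3) : ℂ :=
  deriv (fun s => φ s x) t

/-- Partial derivative in the `j`-th coordinate direction. -/
def pdir (j : Fin 3) (f : E3 → ℂ) (x : E3) : ℂ :=
  fderiv ℝ f x (EuclideanSpace.single j 1)

/-- Laplacian on `ℝ³`. -/
def lap (f : E3 → ℂ) (x : E3) : ℂ :=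
  ∑ j : Fin 3, pdir j (pdir j f) x

/-- Convolution `(w * |φ|²)(x)`, as a complex number. -/
def convPot (w : E3 → ℝ) (φ : E3 → ℂ) (x : E3) : ℂ :=
  ∫ y : E3, ((w (x - y) * ‖φ y‖ ^ 2 : ℝ) : ℂ)

/-- `φ` is a smooth global solution of the Hartree equation
`(1/i) ∂ₜ φ − Δφ + (v_N * |φ|²) φ = 0` on `[0,∞) × ℝ³`, with data `φ₀`. -/
def IsHartreeSolution (vN : E3 → ℝ) (φ : ℝ → E3 → ℂ) (φ₀ : E3 → ℂ) : Prop :=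
  ContDiff ℝ (⊤ : ℕ∞) (fun q : ℝ × E3 => φ q.1 q.2) ∧
  (∀ x, φ 0 x = φ₀ x) ∧
  ∀ t, 0 ≤ t → ∀ x,
    (1 / Complex.I) * timeDeriv φ t x - lap (φ t) x
      + convPot vN (φ t) x * φ t x = 0

/-- The `H^s(ℝ³)` Sobolev norm, defined via the Fourier transform. -/
def hSobNorm (s : ℝ) (f : E3 → ℂ) : ℝ≥0∞ :=
  eLpNorm (fun ξ : E3 => (((1 + ‖ξ‖ ^ 2) ^ (s / 2) : ℝ) : ℂ) * 𝓕 f ξ) 2 volume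

/-- The `W^{k,1}(ℝ³)` Sobolev norm: `k` derivatives in `L¹`. -/
def wk1Norm (k : ℕ) (f : E3 → ℂ) : ℝ≥0∞ :=
  ∑ i ∈ Finset.range (k + 1), eLpNorm (iteratedFDeriv ℝ i f) 1 volume

/-- `|φ|²` as a complex number: `φ conj(φ)`. -/
def absSq (φ : ℝ → E3 → ℂ) (t : ℝ) (x : E3) : ℂ :=
  φ t x * (starRingEnd ℂ) (φ t x)

/-- Mass density `ρ = (1/2)|φ|²`. -/
def rhoD (φ : ℝ → E3 → ℂ) (t : ℝ) (x : E3) : ℂ :=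
  (1 / 2 : ℂ) * absSq φ t x

/-- Momentum density `p_j = (1/2i)(φ ∇_j conj(φ) − conj(φ) ∇_j φ)`. -/
def momD (j : Fin 3) (φ : ℝ → E3 → ℂ) (t : ℝ) (x : E3) : ℂ :=
  (1 / (2 * Complex.I)) *
    (φ t x * pdir j (fun y => (starRingEnd ℂ) (φ t y)) x -
      (starRingEnd ℂ) (φ t x) * pdir j (φ t) x)

/-- Stress tensor `σ_{jk} = ∇_j conj(φ) ∇_k φ + ∇_k conj(φ) ∇_j φ`. -/
def sigmaD (j k : Fin 3) (φ : ℝ → E3 → ℂ) (t : ℝ) (x : E3) : ℂ :=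
  pdir j (fun y => (starRingEnd ℂ) (φ t y)) x * pdir k (φ t) x +
    pdir k (fun y => (starRingEnd ℂ) (φ t y)) x * pdir j (φ t) x

/-- Energy flux `σ_{0j} = ∇_j conj(φ) ∂ₜφ + ∂ₜ conj(φ) ∇_j φ`. -/
def sigma0D (j : Fin 3) (φ : ℝ → E3 → ℂ) (t : ℝ) (x : E3) : ℂ :=
  pdir j (fun y => (starRingEnd ℂ) (φ t y)) x * timeDeriv φ t x +
    (starRingEnd ℂ) (timeDeriv φ t x) * pdir j (φ t) x

/-- Energy density `e = |∇φ|² + (1/2)(v_N * |φ|²)|φ|²`. -/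
def energyD (vN : E3 → ℝ) (φ : ℝ → E3 → ℂ) (t : ℝ) (x : E3) : ℂ :=
  (∑ j : Fin 3, (starRingEnd ℂ) (pdir j (φ t) x) * pdir j (φ t) x) +
    (1 / 2 : ℂ) * convPot vN (φ t) x * absSq φ t x

/-- `λ = (1/2)(Δ|φ|² − (v_N * |φ|²)|φ|²)`. -/
def lamD (vN : E3 → ℝ) (φ : ℝ → E3 → ℂ) (t : ℝ) (x : E3) : ℂ :=
  (1 / 2 : ℂ) * (lap (fun y => absSq φ t y) x - convPot vN (φ t) x * absSq φ t x)

/-- Convolution `(v_N * u)(x) = ∫ v_N(x−y) u(y) dy` for a complex density `u`. -/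
def convC (vN : E3 → ℝ) (u : E3 → ℂ) (x : E3) : ℂ :=
  ∫ y : E3, ((vN (x - y) : ℝ) : ℂ) * u y

/-- `l_j = 2((v_N * ρ) ∇_j ρ − (v_N * ∇_j ρ) ρ)`. -/
def lJ (j : Fin 3) (vN : E3 → ℝ) (φ : ℝ → E3 → ℂ) (t : ℝ) (x : E3) : ℂ :=
  2 * (convC vN (fun y => rhoD φ t y) x * pdir j (fun y => rhoD φ t y) x -
        convC vN (fun y => pdir j (fun y' => rhoD φ t y') y) x * rhoD φ t x)

/-- `l_0 = 2((v_N * ρ) ∂ₜρ − (v_N * ∂ₜρ) ρ)`. -/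
def l0 (vN : E3 → ℝ) (φ : ℝ → E3 → ℂ) (t : ℝ) (x : E3) : ℂ :=
  2 * (convC vN (fun y => rhoD φ t y) x * deriv (fun s => rhoD φ s x) t -
        convC vN (fun y => deriv (fun s => rhoD φ s y) t) x * rhoD φ t x)

/-- Spacetime directional derivative. -/
def Dd (u : ℝ × E3) (G : ℝ × E3 → ℂ) (q : ℝ × E3) : ℂ := fderiv ℝ G q u

/-- Spatial unit direction. -/
def eS (j : Fin 3) : ℝ × E3 := (0, EuclideanSpace.single j 1)

/-- Time unit direction. -/
def eT : ℝ × E3 := (1, 0)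

lemma vScaled_continuous (N : ℕ) (β : ℝ) (v : E3 → ℝ) (hv : IsAdmissiblePotential v) :
    Continuous (vScaled N β v) := by
  have := hv.1.continuous
  unfold vScaled
  fun_prop

lemma vScaled_support (N : ℕ) (β : ℝ) (v : E3 → ℝ) (hN : 1 ≤ N) (hv : IsAdmissiblePotential v) :
    HasCompactSupport (vScaled N β v) := by
  have hne : ((N : ℝ) ^ β) ≠ 0 := by
    have : (0 : ℝ) < N := by exact_mod_cast hN
    positivity
  have h := hv.2.1.comp_smul hne
  exact h.mul_left (f := fun _ => (N : ℝ) ^ (3 * β))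

lemma conv_hasFDerivAt (w : E3 → ℝ) (hw : Continuous w) (hs : HasCompactSupport w)
    (A : ℝ × E3 → ℂ) (hA : ContDiff ℝ (⊤ : ℕ∞) A) (q : ℝ × E3) :
    HasFDerivAt (fun p : ℝ × E3 => ∫ y : E3, w y • A (p - (0, y)))
      (∫ y : E3, w y • fderiv ℝ A (q - (0, y))) q := by
  have hAc : Continuous A := hA.continuous
  have hA' : Continuous (fderiv ℝ A) := hA.continuous_fderiv (by simp)
  have hcomp : IsCompact (Metric.closedBall q 1 ×ˢ tsupport w) :=
    (isCompact_closedBall q 1).prod hs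
  obtain ⟨M, hM⟩ := hcomp.exists_bound_of_continuousOn
    (f := fun z : (ℝ × E3) × E3 => fderiv ℝ A (z.1 - (0, z.2)))
    (by fun_prop)
  refine hasFDerivAt_integral_of_dominated_of_fderiv_le (s := Metric.closedBall q 1)
    (F' := fun p y => w y • fderiv ℝ A (p - (0, y))) (bound := fun y => |w y| * M)
    (Metric.closedBall_mem_nhds q one_pos) ?_ ?_ ?_ ?_ ?_ ?_
  · exact Filter.Eventually.of_forall fun p => by
      apply Continuous.aestronglyMeasurable
      fun_prop
  · apply Continuous.integrable_of_hasCompactSupport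
    · fun_prop
    · exact hs.smul_right
  · apply Continuous.aestronglyMeasurable
    fun_prop
  · refine Filter.Eventually.of_forall fun y p hp => ?_
    rw [norm_smul, Real.norm_eq_abs]
    by_cases hy : y ∈ tsupport w
    · exact mul_le_mul_of_nonneg_left (hM (p, y) ⟨hp, hy⟩) (abs_nonneg _)
    · simp [image_eq_zero_of_notMem_tsupport hy]
  · apply Continuous.integrable_of_hasCompactSupport
    · fun_prop
    · have : HasCompactSupport fun y => |w y| := hs.norm
      exact this.mul_right
  · refine Filter.Eventually.of_forall fun y p hp => ?_
    have h1 : HasFDerivAt A (fderiv ℝ A (p - (0, y))) (p - (0, y)) :=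
      ((hA.differentiable (by simp)) _).hasFDerivAt
    have h2 : HasFDerivAt (fun p : ℝ × E3 => A (p - (0, y))) (fderiv ℝ A (p - (0, y))) p := by
      have h3 := h1.comp p ((hasFDerivAt_id p).sub_const ((0 : ℝ), y))
      rw [ContinuousLinearMap.comp_id] at h3
      exact h3
    exact h2.const_smul (w y)

/-- Spacetime convolution potential. -/
def Wc (w : E3 → ℝ) (A : ℝ × E3 → ℂ) (q : ℝ × E3) : ℂ := convC w (fun y => A (q.1, y)) q.2

lemma Wc_eq (w : E3 → ℝ) (A : ℝ × E3 → ℂ) (q : ℝ × E3) :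
    Wc w A q = ∫ y : E3, w y • A (q - (0, y)) := by
  unfold Wc convC
  rw [← integral_sub_left_eq_self _ volume q.2]
  congr 1; ext y
  simp [Prod.sub_def]

lemma Wc_diff (w : E3 → ℝ) (hw : Continuous w) (hs : HasCompactSupport w)
    (A : ℝ × E3 → ℂ) (hA : ContDiff ℝ (⊤ : ℕ∞) A) : Differentiable ℝ (Wc w A) := by
  rw [show Wc w A = _ from funext (Wc_eq w A)]
  exact fun q => (conv_hasFDerivAt w hw hs A hA q).differentiableAt

lemma Wc_D (w : E3 → ℝ) (hw : Continuous w) (hs : HasCompactSupport w)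
    (A : ℝ × E3 → ℂ) (hA : ContDiff ℝ (⊤ : ℕ∞) A) (u q : ℝ × E3) :
    Dd u (Wc w A) q = Wc w (Dd u A) q := by
  have hA' : Continuous (fderiv ℝ A) := hA.continuous_fderiv (by simp)
  rw [Wc_eq]
  unfold Dd
  rw [show Wc w A = _ from funext (Wc_eq w A), (conv_hasFDerivAt w hw hs A hA q).fderiv,
    ContinuousLinearMap.integral_apply]
  · rfl
  · apply Continuous.integrable_of_hasCompactSupport
    · fun_prop
    · exact hs.smul_right

lemma Dd_smooth (u : ℝ × E3) (G : ℝ × E3 → ℂ) (hG : ContDiff ℝ (⊤ : ℕ∞) G) :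
    ContDiff ℝ (⊤ : ℕ∞) (Dd u G) :=
  (hG.fderiv_right (m := (⊤ : ℕ∞)) (by simp)).clm_apply contDiff_const

lemma Dd_comm (u u' : ℝ × E3) (G : ℝ × E3 → ℂ) (hG : ContDiff ℝ (⊤ : ℕ∞) G) (q : ℝ × E3) :
    Dd u (Dd u' G) q = Dd u' (Dd u G) q := by
  have hd : DifferentiableAt ℝ (fderiv ℝ G) q :=
    ((hG.fderiv_right (m := (⊤ : ℕ∞)) (by simp)).differentiable (by simp)) q
  have key : ∀ a b : ℝ × E3, Dd a (Dd b G) q = fderiv ℝ (fderiv ℝ G) q a b := by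
    intro a b
    unfold Dd
    rw [fderiv_clm_apply hd (by fun_prop)]
    simp
  rw [key, key]
  have := (hG.contDiffAt (x := q)).isSymmSndFDerivAt (by
    rw [minSmoothness_of_isRCLikeNormedField]
    exact WithTop.coe_le_coe.2 (le_top : (2 : ℕ∞) ≤ ⊤))
  exact this.eq u u'

lemma Dd_mul (u : ℝ × E3) (f g : ℝ × E3 → ℂ) (q : ℝ × E3) (hf : DifferentiableAt ℝ f q)
    (hg : DifferentiableAt ℝ g q) :
    Dd u (fun q => f q * g q) q = Dd u f q * g q + f q * Dd u g q := by
  unfold Dd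
  rw [fderiv_fun_mul hf hg]
  simp; ring

lemma Dd_add (u : ℝ × E3) (f g : ℝ × E3 → ℂ) (q : ℝ × E3) (hf : DifferentiableAt ℝ f q)
    (hg : DifferentiableAt ℝ g q) :
    Dd u (fun q => f q + g q) q = Dd u f q + Dd u g q := by
  unfold Dd
  rw [fderiv_fun_add hf hg]
  simp

lemma Dd_sub (u : ℝ × E3) (f g : ℝ × E3 → ℂ) (q : ℝ × E3) (hf : DifferentiableAt ℝ f q)
    (hg : DifferentiableAt ℝ g q) :
    Dd u (fun q => f q - g q) q = Dd u f q - Dd u g q := by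
  unfold Dd
  rw [fderiv_fun_sub hf hg]
  simp

lemma Dd_sum (u : ℝ × E3) (f : Fin 3 → ℝ × E3 → ℂ) (q : ℝ × E3)
    (hf : ∀ i, DifferentiableAt ℝ (f i) q) :
    Dd u (fun q => ∑ i, f i q) q = ∑ i, Dd u (f i) q := by
  unfold Dd
  rw [fderiv_fun_sum fun i _ => hf i]
  simp

lemma Dd_const (u : ℝ × E3) (c : ℂ) (q : ℝ × E3) : Dd u (fun _ => c) q = 0 := by
  simp [Dd]

lemma Dd_cmul (u : ℝ × E3) (c : ℂ) (f : ℝ × E3 → ℂ) (q : ℝ × E3) (hf : DifferentiableAt ℝ f q) :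
    Dd u (fun q => c * f q) q = c * Dd u f q := by
  rw [Dd_mul u (fun _ => c) f q (by fun_prop) hf, Dd_const]; ring

lemma Dd_conj (u : ℝ × E3) (f : ℝ × E3 → ℂ) (q : ℝ × E3) (hf : DifferentiableAt ℝ f q) :
    Dd u (fun q => (starRingEnd ℂ) (f q)) q = (starRingEnd ℂ) (Dd u f q) := by
  unfold Dd
  have := (Complex.conjCLE.toContinuousLinearMap.hasFDerivAt (x := f q)).comp q hf.hasFDerivAt
  have h2 : HasFDerivAt (fun q => (starRingEnd ℂ) (f q)) _ q := this
  rw [h2.fderiv]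
  simp

lemma pdir_eq (j : Fin 3) (G : ℝ × E3 → ℂ) (t : ℝ) (x : E3) (hG : DifferentiableAt ℝ G (t, x)) :
    pdir j (fun y => G (t, y)) x = Dd (eS j) G (t, x) := by
  unfold pdir Dd eS
  have := hG.hasFDerivAt.comp x (hasFDerivAt_prodMk_right t x)
  have h2 : HasFDerivAt (fun y => G (t, y)) _ x := this
  rw [h2.fderiv]
  simp

lemma tder_eq (G : ℝ × E3 → ℂ) (t : ℝ) (x : E3) (hG : DifferentiableAt ℝ G (t, x)) :
    deriv (fun s => G (s, x)) t = Dd eT G (t, x) := by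
  unfold Dd eT
  have := hG.hasFDerivAt.comp t (hasFDerivAt_prodMk_left (𝕜 := ℝ) t x)
  have h2 : HasFDerivAt (fun s => G (s, x)) _ t := this
  rw [h2.hasDerivAt.deriv]
  simp

lemma inv_two_I : (1 / (2 * Complex.I) : ℂ) = -Complex.I / 2 := by
  have := Complex.I_ne_zero
  field_simp
  simp

lemma core_mass (F C W : ℝ × E3 → ℂ) (hF : ContDiff ℝ (⊤ : ℕ∞) F) (hC : ContDiff ℝ (⊤ : ℕ∞) C)
    (q : ℝ × E3)
    (hE : -I * Dd eT F q = ∑ k, Dd (eS k) (Dd (eS k) F) q - W q * F q)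
    (hE' : I * Dd eT C q = ∑ k, Dd (eS k) (Dd (eS k) C) q - W q * C q) :
    Dd eT (fun q => (1 / 2 : ℂ) * (F q * C q)) q
      - ∑ j, Dd (eS j) (fun q => (1 / (2 * I)) *
        (F q * Dd (eS j) C q - C q * Dd (eS j) F q)) q = 0 := by
  have dF : Differentiable ℝ F := hF.differentiable (by simp)
  have dC : Differentiable ℝ C := hC.differentiable (by simp)
  have dF1 : ∀ u, Differentiable ℝ (Dd u F) := fun u =>
    (Dd_smooth u F hF).differentiable (by simp)
  have dC1 : ∀ u, Differentiable ℝ (Dd u C) := fun u =>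
    (Dd_smooth u C hC).differentiable (by simp)
  simp (disch := fun_prop) only [Dd_cmul, Dd_mul, Dd_sub, inv_two_I]
  simp only [Fin.sum_univ_three] at *
  linear_combination (I * C q / 2) * hE - (I * F q / 2) * hE'
    + (Dd eT F q * C q + F q * Dd eT C q) / 2 * I_sq

lemma core_mom (F C W : ℝ × E3 → ℂ) (hF : ContDiff ℝ (⊤ : ℕ∞) F) (hC : ContDiff ℝ (⊤ : ℕ∞) C)
    (hW : Differentiable ℝ W) (q : ℝ × E3) (j : Fin 3)
    (hE : -I * Dd eT F q = ∑ k, Dd (eS k) (Dd (eS k) F) q - W q * F q)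
    (hE' : I * Dd eT C q = ∑ k, Dd (eS k) (Dd (eS k) C) q - W q * C q)
    (hJ : -I * Dd (eS j) (Dd eT F) q = ∑ k, Dd (eS j) (Dd (eS k) (Dd (eS k) F)) q
      - (Dd (eS j) W q * F q + W q * Dd (eS j) F q))
    (hJ' : I * Dd (eS j) (Dd eT C) q = ∑ k, Dd (eS j) (Dd (eS k) (Dd (eS k) C)) q
      - (Dd (eS j) W q * C q + W q * Dd (eS j) C q)) :
    Dd eT (fun q => (1 / (2 * I)) * (F q * Dd (eS j) C q - C q * Dd (eS j) F q)) q
      - (∑ k, Dd (eS k) (fun q => (Dd (eS j) C q * Dd (eS k) F q + Dd (eS k) C q * Dd (eS j) F q)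
          - (if j = k then (1 / 2 : ℂ) * (∑ k, Dd (eS k) (Dd (eS k) (fun q => F q * C q)) q
            - W q * (F q * C q)) else 0)) q)
      + 2 * ((1 / 2 * W q) * Dd (eS j) (fun q => (1 / 2 : ℂ) * (F q * C q)) q
        - (1 / 2 * Dd (eS j) W q) * ((1 / 2 : ℂ) * (F q * C q))) = 0 := by
  have dF : Differentiable ℝ F := hF.differentiable (by simp)
  have dC : Differentiable ℝ C := hC.differentiable (by simp)
  have dF1 : ∀ u, Differentiable ℝ (Dd u F) := fun u =>
    (Dd_smooth u F hF).differentiable (by simp)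
  have dC1 : ∀ u, Differentiable ℝ (Dd u C) := fun u =>
    (Dd_smooth u C hC).differentiable (by simp)
  have dF2 : ∀ u u', Differentiable ℝ (Dd u (Dd u' F)) := fun u u' =>
    (Dd_smooth u _ (Dd_smooth u' F hF)).differentiable (by simp)
  have dC2 : ∀ u u', Differentiable ℝ (Dd u (Dd u' C)) := fun u u' =>
    (Dd_smooth u _ (Dd_smooth u' C hC)).differentiable (by simp)
  have hA1 : ∀ u, Dd u (fun q => F q * C q) = fun q => Dd u F q * C q + F q * Dd u C q := by
    intro u; ext p
    exact Dd_mul u F C p (dF p) (dC p)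
  have hA2 : ∀ u, Dd u (Dd u (fun q => F q * C q)) = fun q =>
      Dd u (Dd u F) q * C q + 2 * (Dd u F q * Dd u C q) + F q * Dd u (Dd u C) q := by
    intro u; rw [hA1]; ext p
    simp (disch := fun_prop) only [Dd_add, Dd_mul]
    ring
  simp only [hA2]
  have hS : ∀ k, Dd (eS k) (fun q => (Dd (eS j) C q * Dd (eS k) F q
        + Dd (eS k) C q * Dd (eS j) F q)
          - (if j = k then (1 / 2 : ℂ) * (∑ u, (Dd (eS u) (Dd (eS u) F) q * C q
            + 2 * (Dd (eS u) F q * Dd (eS u) C q) + F q * Dd (eS u) (Dd (eS u) C) q)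
            - W q * (F q * C q)) else 0)) q
      = (Dd (eS j) (Dd (eS k) C) q * Dd (eS k) F q + Dd (eS j) C q * Dd (eS k) (Dd (eS k) F) q
        + (Dd (eS k) (Dd (eS k) C) q * Dd (eS j) F q + Dd (eS k) C q * Dd (eS j) (Dd (eS k) F) q))
        - (if j = k then Dd (eS j) (fun q => (1 / 2 : ℂ) * (∑ u, (Dd (eS u) (Dd (eS u) F) q * C q
            + 2 * (Dd (eS u) F q * Dd (eS u) C q) + F q * Dd (eS u) (Dd (eS u) C) q)
            - W q * (F q * C q))) q else 0) := by
    intro k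
    rw [Dd_comm (eS j) (eS k) F hF, Dd_comm (eS j) (eS k) C hC]
    by_cases h : j = k
    · simp only [h, if_true]
      simp (disch := fun_prop) only [Dd_add, Dd_mul, Dd_sub]
    · simp only [h, if_false, sub_zero]
      simp (disch := fun_prop) only [Dd_add, Dd_mul]
  rw [Finset.sum_congr rfl fun k _ => hS k, Finset.sum_sub_distrib, Finset.sum_ite_eq]
  simp only [Finset.mem_univ, if_true]
  simp (disch := fun_prop) only [Dd_cmul, Dd_mul, Dd_sub, Dd_add, Dd_sum, inv_two_I]
  rw [Dd_comm eT (eS j) F hF, Dd_comm eT (eS j) C hC]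
  simp only [Fin.sum_univ_three] at *
  linear_combination (Dd (eS j) C q / 2) * hE + (Dd (eS j) F q / 2) * hE'
    - (F q / 2) * hJ' - (C q / 2) * hJ

lemma core_energy (F C W : ℝ × E3 → ℂ) (hF : ContDiff ℝ (⊤ : ℕ∞) F)
    (hC : ContDiff ℝ (⊤ : ℕ∞) C) (hW : Differentiable ℝ W) (q : ℝ × E3)
    (hE : -I * Dd eT F q = ∑ k, Dd (eS k) (Dd (eS k) F) q - W q * F q)
    (hE' : I * Dd eT C q = ∑ k, Dd (eS k) (Dd (eS k) C) q - W q * C q) :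
    Dd eT (fun q => (∑ j, Dd (eS j) C q * Dd (eS j) F q) + (1 / 2 : ℂ) * W q * (F q * C q)) q
      - ∑ j, Dd (eS j) (fun q => Dd (eS j) C q * Dd eT F q + Dd eT C q * Dd (eS j) F q) q
      + 2 * ((1 / 2 * W q) * Dd eT (fun q => (1 / 2 : ℂ) * (F q * C q)) q
        - (1 / 2 * Dd eT W q) * ((1 / 2 : ℂ) * (F q * C q))) = 0 := by
  have dF : Differentiable ℝ F := hF.differentiable (by simp)
  have dC : Differentiable ℝ C := hC.differentiable (by simp)
  have dF1 : ∀ u, Differentiable ℝ (Dd u F) := fun u =>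
    (Dd_smooth u F hF).differentiable (by simp)
  have dC1 : ∀ u, Differentiable ℝ (Dd u C) := fun u =>
    (Dd_smooth u C hC).differentiable (by simp)
  simp (disch := fun_prop) only [Dd_cmul, Dd_mul, Dd_add, Dd_sum]
  simp only [fun j => Dd_comm eT (eS j) F hF q, fun j => Dd_comm eT (eS j) C hC q]
  simp only [Fin.sum_univ_three] at *
  linear_combination Dd eT C q * hE + Dd eT F q * hE'

/-- Local conservation laws (mass, momentum, energy) for smooth,
decaying solutions of the Hartree equation. -/
theorem hartree_local_conservation_laws
    (N : ℕ) (β : ℝ) (v : E3 → ℝ) (φ : ℝ → E3 → ℂ)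
    (hN : 1 ≤ N) (hβ0 : 0 < β) (hβ1 : β < 1) (hv : IsAdmissiblePotential v)
    (hsmooth : ContDiff ℝ (⊤ : ℕ∞) (fun q : ℝ × E3 => φ q.1 q.2))
    (hdecay : ∀ t : ℝ, ∃ S : SchwartzMap E3 ℂ, ∀ x, φ t x = S x)
    (hdecay' : ∀ t : ℝ, ∃ S : SchwartzMap E3 ℂ, ∀ x, timeDeriv φ t x = S x)
    (heq : ∀ t, 0 ≤ t → ∀ x,
      (1 / Complex.I) * timeDeriv φ t x - lap (φ t) x
        + convPot (vScaled N β v) (φ t) x * φ t x = 0) :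
    ∀ t, 0 ≤ t → ∀ x : E3,
      (deriv (fun s => rhoD φ s x) t
          - ∑ j : Fin 3, pdir j (fun y => momD j φ t y) x = 0) ∧
      (∀ j : Fin 3,
        deriv (fun s => momD j φ s x) t
            - (∑ k : Fin 3,
                pdir k (fun y => sigmaD j k φ t y
                    - (if j = k then lamD (vScaled N β v) φ t y else 0)) x)
            + lJ j (vScaled N β v) φ t x = 0) ∧
      (deriv (fun s => energyD (vScaled N β v) φ s x) t
          - ∑ j : Fin 3, pdir j (fun y => sigma0D j φ t y) x
          + l0 (vScaled N β v) φ t x = 0) := by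
  set w := vScaled N β v with hw
  have hwc : Continuous w := vScaled_continuous N β v hv
  have hws : HasCompactSupport w := vScaled_support N β v hN hv
  obtain ⟨F, hFdef⟩ : ∃ F : ℝ × E3 → ℂ, ∀ t x, φ t x = F (t, x) :=
    ⟨fun q => φ q.1 q.2, fun _ _ => rfl⟩
  have hF : ContDiff ℝ (⊤ : ℕ∞) F := by
    convert hsmooth using 1
    ext ⟨t, x⟩
    exact (hFdef t x).symm
  obtain rfl : φ = fun t x => F (t, x) := by
    ext t x; exact hFdef t x
  obtain ⟨C, hCdef⟩ : ∃ C : ℝ × E3 → ℂ, C = fun q => (starRingEnd ℂ) (F q) := ⟨_, rfl⟩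
  have hCq : ∀ q, (starRingEnd ℂ) (F q) = C q := fun q => by rw [hCdef]
  have hC : ContDiff ℝ (⊤ : ℕ∞) C := by
    rw [hCdef]
    exact Complex.conjCLE.toContinuousLinearMap.contDiff.comp hF
  have dF : Differentiable ℝ F := hF.differentiable (by simp)
  have dC : Differentiable ℝ C := hC.differentiable (by simp)
  have sF1 : ∀ u, ContDiff ℝ (⊤ : ℕ∞) (Dd u F) := fun u => Dd_smooth u F hF
  have sC1 : ∀ u, ContDiff ℝ (⊤ : ℕ∞) (Dd u C) := fun u => Dd_smooth u C hC
  have dF1 : ∀ u, Differentiable ℝ (Dd u F) := fun u => (sF1 u).differentiable (by simp)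
  have dC1 : ∀ u, Differentiable ℝ (Dd u C) := fun u => (sC1 u).differentiable (by simp)
  have dF2 : ∀ u u', Differentiable ℝ (Dd u (Dd u' F)) := fun u u' =>
    (Dd_smooth u _ (sF1 u')).differentiable (by simp)
  have dC2 : ∀ u u', Differentiable ℝ (Dd u (Dd u' C)) := fun u u' =>
    (Dd_smooth u _ (sC1 u')).differentiable (by simp)
  have hconj : ∀ u q, (starRingEnd ℂ) (Dd u F q) = Dd u C q := fun u q => by
    rw [hCdef, Dd_conj u F q (dF q)]
  have hconj2 : ∀ u u' q, (starRingEnd ℂ) (Dd u (Dd u' F) q) = Dd u (Dd u' C) q :=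
    fun u u' q => by
      rw [← Dd_conj u _ q (dF1 u' q)]
      congr 1; ext p; exact hconj u' p
  obtain ⟨A, hAdef⟩ : ∃ A : ℝ × E3 → ℂ, A = fun q => F q * C q := ⟨_, rfl⟩
  have hA : ContDiff ℝ (⊤ : ℕ∞) A := by rw [hAdef]; exact hF.mul hC
  have dA : Differentiable ℝ A := hA.differentiable (by simp)
  have dA1 : ∀ u, Differentiable ℝ (Dd u A) := fun u =>
    (Dd_smooth u A hA).differentiable (by simp)
  have dA2 : ∀ u u', Differentiable ℝ (Dd u (Dd u' A)) := fun u u' =>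
    (Dd_smooth u _ (Dd_smooth u' A hA)).differentiable (by simp)
  obtain ⟨W, hWdef⟩ : ∃ W, W = Wc w A := ⟨_, rfl⟩
  have dW : Differentiable ℝ W := by rw [hWdef]; exact Wc_diff w hwc hws A hA
  have hWD : ∀ u t x, convC w (fun y => Dd u A (t, y)) x = Dd u W (t, x) := by
    intro u t x
    rw [hWdef, Wc_D w hwc hws A hA]
    rfl
  have hWpot : ∀ t x, convPot w (fun x => F (t, x)) x = W (t, x) := by
    intro t x
    rw [hWdef]
    unfold convPot Wc convC
    congr 1; ext y
    rw [hAdef]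
    simp only [← hCq, Complex.mul_conj, Complex.normSq_eq_norm_sq]
    push_cast
    ring
  have hWreal : ∀ t x, (starRingEnd ℂ) (W (t, x)) = W (t, x) := by
    intro t x
    rw [← hWpot]
    unfold convPot
    rw [← integral_conj]
    simp only [Complex.conj_ofReal]
  -- rewriting the densities
  have pF : ∀ j t x, pdir j (fun x => F (t, x)) x = Dd (eS j) F (t, x) :=
    fun j t x => pdir_eq j F t x (dF _)
  have pC : ∀ j t x, pdir j (fun x => C (t, x)) x = Dd (eS j) C (t, x) :=
    fun j t x => pdir_eq j C t x (dC _)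
  have tF : ∀ t x, timeDeriv (fun t x => F (t, x)) t x = Dd eT F (t, x) :=
    fun t x => tder_eq F t x (dF _)
  have lapG : ∀ G : ℝ × E3 → ℂ, ContDiff ℝ (⊤ : ℕ∞) G → ∀ t x,
      lap (fun x => G (t, x)) x = ∑ k, Dd (eS k) (Dd (eS k) G) (t, x) := by
    intro G hG t x
    unfold lap
    refine Finset.sum_congr rfl fun k _ => ?_
    have : pdir k (fun x => G (t, x)) = fun y => Dd (eS k) G (t, y) := by
      ext y; exact pdir_eq k G t y (hG.differentiable (by simp) _)
    rw [this, pdir_eq k _ t x ((Dd_smooth _ G hG).differentiable (by simp) _)]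
  have rA : ∀ t x, absSq (fun t x => F (t, x)) t x = A (t, x) := by
    intro t x; simp only [absSq, hAdef, hCq]
  have rR : ∀ t x, rhoD (fun t x => F (t, x)) t x = (1 / 2 : ℂ) * A (t, x) := by
    intro t x; simp only [rhoD, rA]
  have rM : ∀ j t x, momD j (fun t x => F (t, x)) t x = (1 / (2 * I)) *
        (F (t, x) * Dd (eS j) C (t, x) - C (t, x) * Dd (eS j) F (t, x)) := by
    intro j t x; simp only [momD, hCq, pF, pC]
  have rS : ∀ j k t x, sigmaD j k (fun t x => F (t, x)) t x =
      Dd (eS j) C (t, x) * Dd (eS k) F (t, x) + Dd (eS k) C (t, x) * Dd (eS j) F (t, x) := by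
    intro j k t x; simp only [sigmaD, hCq, pF, pC]
  have rS0 : ∀ j t x, sigma0D j (fun t x => F (t, x)) t x =
      Dd (eS j) C (t, x) * Dd eT F (t, x) + Dd eT C (t, x) * Dd (eS j) F (t, x) := by
    intro j t x; simp only [sigma0D, hCq, pF, pC, tF, hconj]
  have rE : ∀ t x, energyD w (fun t x => F (t, x)) t x =
      (∑ j, Dd (eS j) C (t, x) * Dd (eS j) F (t, x)) + (1 / 2 : ℂ) * W (t, x) * A (t, x) := by
    intro t x; simp only [energyD, hWpot, rA, pF, hconj]
  have rL : ∀ t x, lamD w (fun t x => F (t, x)) t x =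
      (1 / 2 : ℂ) * (∑ k, Dd (eS k) (Dd (eS k) A) (t, x) - W (t, x) * A (t, x)) := by
    intro t x; simp only [lamD, hWpot, rA, lapG A hA]
  -- the equation and its derivatives
  have hE : ∀ t, 0 ≤ t → ∀ x, -I * Dd eT F (t, x)
      = ∑ k, Dd (eS k) (Dd (eS k) F) (t, x) - W (t, x) * F (t, x) := by
    intro t ht x
    have h := heq t ht x
    rw [tF, lapG F hF, hWpot, one_div, Complex.inv_I] at h
    linear_combination h
  have hE' : ∀ t, 0 ≤ t → ∀ x, I * Dd eT C (t, x)
      = ∑ k, Dd (eS k) (Dd (eS k) C) (t, x) - W (t, x) * C (t, x) := by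
    intro t ht x
    have h := congrArg (starRingEnd ℂ) (hE t ht x)
    simpa only [map_mul, map_neg, map_sub, map_sum, Complex.conj_I, neg_neg, hconj, hconj2,
      hWreal, hCq] using h
  have hJgen : ∀ G : ℝ × E3 → ℂ, ContDiff ℝ (⊤ : ℕ∞) G → ∀ c : ℂ,
      (∀ t, 0 ≤ t → ∀ x, c * Dd eT G (t, x)
        = ∑ k, Dd (eS k) (Dd (eS k) G) (t, x) - W (t, x) * G (t, x)) →
      ∀ t, 0 ≤ t → ∀ x j, c * Dd (eS j) (Dd eT G) (t, x)
        = ∑ k, Dd (eS j) (Dd (eS k) (Dd (eS k) G)) (t, x)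
          - (Dd (eS j) W (t, x) * G (t, x) + W (t, x) * Dd (eS j) G (t, x)) := by
    intro G hG c h t ht x j
    have dG : Differentiable ℝ G := hG.differentiable (by simp)
    have dG1 : ∀ u, Differentiable ℝ (Dd u G) := fun u =>
      (Dd_smooth u G hG).differentiable (by simp)
    have dG2 : ∀ u u', Differentiable ℝ (Dd u (Dd u' G)) := fun u u' =>
      (Dd_smooth u _ (Dd_smooth u' G hG)).differentiable (by simp)
    have h1 : (fun y => (fun q => c * Dd eT G q) (t, y)) = fun y =>
        (fun q => ∑ k, Dd (eS k) (Dd (eS k) G) q - W q * G q) (t, y) := by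
      ext y; exact h t ht y
    have h2 := congrArg (fun f => pdir j f x) h1
    simp only at h2
    rw [pdir_eq j (fun q => c * Dd eT G q) t x (by fun_prop),
      pdir_eq j (fun q => ∑ k, Dd (eS k) (Dd (eS k) G) q - W q * G q) t x (by fun_prop)] at h2
    simp (disch := fun_prop) only [Dd_cmul, Dd_mul, Dd_sub, Dd_sum] at h2
    exact h2
  have hJ := hJgen F hF _ hE
  have hJ' := hJgen C hC _ hE'
  have convHalf : ∀ (u : E3 → ℂ) x, convC w (fun y => (1 / 2 : ℂ) * u y) x
      = 1 / 2 * convC w u x := by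
    intro u x
    unfold convC
    rw [← integral_const_mul]
    congr 1; ext y; ring
  have cR : ∀ t x, convC w (fun y => rhoD (fun t x => F (t, x)) t y) x = 1 / 2 * W (t, x) := by
    intro t x
    simp only [rR]
    rw [convHalf, hWdef]; rfl
  have pR : ∀ j t x, pdir j (fun y => rhoD (fun t x => F (t, x)) t y) x
      = Dd (eS j) (fun q => (1 / 2 : ℂ) * A q) (t, x) := by
    intro j t x
    simp only [rR]
    exact pdir_eq j (fun q => (1 / 2 : ℂ) * A q) t x (by fun_prop)
  have tR : ∀ t x, deriv (fun s => rhoD (fun t x => F (t, x)) s x) t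
      = Dd eT (fun q => (1 / 2 : ℂ) * A q) (t, x) := by
    intro t x
    simp only [rR]
    exact tder_eq (fun q => (1 / 2 : ℂ) * A q) t x (by fun_prop)
  have cD : ∀ u t x, convC w (fun y => Dd u (fun q => (1 / 2 : ℂ) * A q) (t, y)) x
      = 1 / 2 * Dd u W (t, x) := by
    intro u t x
    simp (disch := fun_prop) only [Dd_cmul]
    rw [convHalf, hWD]
  intro t ht x
  refine ⟨?_, fun j => ?_, ?_⟩
  · rw [tR]
    simp only [rM]
    have h := core_mass F C W hF hC (t, x) (hE t ht x) (hE' t ht x)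
    subst hAdef
    refine Eq.trans ?_ h
    congr 1
    refine Finset.sum_congr rfl fun j _ => ?_
    exact pdir_eq j (fun q => (1 / (2 * I)) *
        (F q * Dd (eS j) C q - C q * Dd (eS j) F q)) t x (by fun_prop)
  · have h := core_mom F C W hF hC dW (t, x) j (hE t ht x) (hE' t ht x) (hJ t ht x j)
      (hJ' t ht x j)
    rw [← hAdef] at h
    simp only [lJ, cR, pR, cD]
    simp only [rR, rM, rS, rL]
    rw [tder_eq (fun q => (1 / (2 * I)) *
        (F q * Dd (eS j) C q - C q * Dd (eS j) F q)) t x (by fun_prop)]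
    have hsum : ∀ k, pdir k (fun y => Dd (eS j) C (t, y) * Dd (eS k) F (t, y)
        + Dd (eS k) C (t, y) * Dd (eS j) F (t, y)
        - (if j = k then (1 / 2 : ℂ) * (∑ k, Dd (eS k) (Dd (eS k) A) (t, y)
            - W (t, y) * A (t, y)) else 0)) x
        = Dd (eS k) (fun q => (Dd (eS j) C q * Dd (eS k) F q + Dd (eS k) C q * Dd (eS j) F q)
          - (if j = k then (1 / 2 : ℂ) * (∑ k, Dd (eS k) (Dd (eS k) A) q
            - W q * A q) else 0)) (t, x) := by
      intro k
      refine pdir_eq k (fun q => (Dd (eS j) C q * Dd (eS k) F q + Dd (eS k) C q * Dd (eS j) F q)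
          - (if j = k then (1 / 2 : ℂ) * (∑ k, Dd (eS k) (Dd (eS k) A) q
            - W q * A q) else 0)) t x ?_
      by_cases hjk : j = k
      · simp only [hjk, if_true]; fun_prop
      · simp only [hjk, if_false]; fun_prop
    rw [Finset.sum_congr rfl fun k _ => hsum k]
    subst hAdef
    exact h
  · have h := core_energy F C W hF hC dW (t, x) (hE t ht x) (hE' t ht x)
    simp only [l0, cR, tR, cD]
    simp only [rR, rE, rS0]
    rw [tder_eq (fun q => (∑ j, Dd (eS j) C q * Dd (eS j) F q)
      + (1 / 2 : ℂ) * W q * A q) t x (by fun_prop)]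
    have hsum : ∀ j, pdir j (fun y => Dd (eS j) C (t, y) * Dd eT F (t, y)
        + Dd eT C (t, y) * Dd (eS j) F (t, y)) x
        = Dd (eS j) (fun q => Dd (eS j) C q * Dd eT F q + Dd eT C q * Dd (eS j) F q) (t, x) :=
      fun j => pdir_eq j (fun q => Dd (eS j) C q * Dd eT F q + Dd eT C q * Dd (eS j) F q) t x
        (by fun_prop)
    rw [Finset.sum_congr rfl fun j _ => hsum j]
    subst hAdef
    exact h
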